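/- Let I ⊆ ℝ be a nonempty open interval and c ∈ ℝ. There do not exist differentiable functions κ, σ : I → ℝ with κ(x) ≠ 0 for all x ∈ I satisfying, for all x ∈ I: σ'(x) = 2κ(x)σ(x), κ'(x) = κ(x)² − σ(x)² + c, and κ(x)² = 3σ(x)² − 3c. -/

import Mathlib

/-- If `σ' = 2κσ` at `x`, `κ x ≠ 0` and `κ² = aσ² + b` near `x`, then `κ' = 2aσ²` at `x`. -/
theorem deriv_eq_of_sq_eventuallyEq {κ σ : ℝ → ℝ} {a b x : ℝ}
    (hκ : DifferentiableAt ℝ κ x) (hσ : DifferentiableAt ℝ σ x) (hκx : κ x ≠ 0)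
    (hσ' : deriv σ x = 2 * κ x * σ x)
    (h : (fun y => κ y ^ 2) =ᶠ[nhds x] fun y => a * σ y ^ 2 + b) :
    deriv κ x = 2 * a * σ x ^ 2 := by
  have h₁ := hκ.hasDerivAt.pow 2
  have h₂ := (((hσ.hasDerivAt.pow 2).const_mul a).add_const b).congr_of_eventuallyEq h
  have h₃ := h₁.unique h₂
  rw [hσ'] at h₃
  norm_num at h₃
  apply mul_left_cancel₀ hκx
  linarith

/-- The contradiction concluding Case II in the proof of Theorem 3.3: on a nonempty open
interval there are no differentiable functions `κ, σ` with `κ` nowhere zero satisfying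
`σ' = 2κσ`, `κ' = κ² − σ² + c` and `κ² = 3σ² − 3c`. -/
theorem no_nonvanishing_kappa
    (I : Set ℝ) (hI : IsOpen I) (hI' : I.OrdConnected) (hne : I.Nonempty) (c : ℝ) :
    ¬ ∃ κ σ : ℝ → ℝ,
        (∀ x ∈ I, DifferentiableAt ℝ κ x) ∧
        (∀ x ∈ I, DifferentiableAt ℝ σ x) ∧
        (∀ x ∈ I, κ x ≠ 0) ∧
        (∀ x ∈ I, deriv σ x = 2 * κ x * σ x) ∧
        (∀ x ∈ I, deriv κ x = κ x ^ 2 - σ x ^ 2 + c) ∧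
        (∀ x ∈ I, κ x ^ 2 = 3 * σ x ^ 2 - 3 * c) := by
  rintro ⟨κ, σ, hκ, hσ, hκ0, hσ', hκ', h⟩
  have key : ∀ a b : ℝ, (∀ x ∈ I, κ x ^ 2 = a * σ x ^ 2 + b) →
      ∀ x ∈ I, deriv κ x = 2 * a * σ x ^ 2 := fun a b hab x hx =>
    deriv_eq_of_sq_eventuallyEq (hκ x hx) (hσ x hx) (hκ0 x hx) (hσ' x hx)
      (Filter.eventually_of_mem (hI.mem_nhds hx) hab)
  have h₃ := key 3 (-3 * c) fun x hx => by linarith [h x hx]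
  have h₇ := key 7 (-c) fun x hx => by linarith [h₃ x hx, hκ' x hx]
  obtain ⟨x, hx⟩ := hne
  apply hκ0 x hx
  apply pow_eq_zero_iff two_ne_zero |>.mp
  linarith [h x hx, h₃ x hx, h₇ x hx, hκ' x hx]
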